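/- arXiv:1503.09046 — 6 statements merged into one kernel-verified Lean document; each statement's English description precedes it below -/
import Mathlib

section
/- Let τ be a real number with 2 < τ < 3 and let D be an ℕ-valued random variable with P(D ≥ 2) = 1, finite mean μ = E[D] ∈ (0,∞), and constants 0 < c₁ ≤ C₁ < ∞ such that c₁·x^{-(τ-1)} ≤ P(D > x) ≤ C₁·x^{-(τ-1)} for all real x ≥ 1. Define f*_j = (j+1)·P(D = j+1)/μ for j ∈ ℕ. Then there exist constants 0 < c₁* ≤ C₁* < ∞ such that for all real x ≥ 1, c₁*·x^{-(τ-2)} ≤ Σ_{j ∈ ℕ, j > x} f*_j ≤ C₁*·x^{-(τ-2)}. -/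
open MeasureTheory

/-- A weighted tail series of the law of an `ℕ`-valued random variable, shifted by one, is a
truncated expectation. -/
lemma tsum_succ_mul_measure_eq_integral
    {Ω : Type*} [MeasurableSpace Ω] (μ : Measure Ω)
    (D : Ω → ℕ) (hD : Measurable D) (hInt : Integrable (fun ω => (D ω : ℝ)) μ) (m x : ℝ)
    (hx : 0 ≤ x) :
    (∑' j : ℕ, if x < (j : ℝ) then ((j : ℝ) + 1) * (μ {ω | D ω = j + 1}).toReal / m else 0) =
      (∫ ω, {ω | x + 1 < (D ω : ℝ)}.indicator (fun ω => (D ω : ℝ)) ω ∂μ) / m := by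
  set g : ℕ → ℝ := fun n => if x + 1 < (n : ℝ) then (n : ℝ) else 0 with hg
  have hgD : {ω | x + 1 < (D ω : ℝ)}.indicator (fun ω => (D ω : ℝ)) = g ∘ D := by
    funext ω
    simp [hg, Set.indicator_apply]
  have hS : MeasurableSet {ω | x + 1 < (D ω : ℝ)} :=
    hD (MeasurableSet.of_discrete (s := {n : ℕ | x + 1 < (n : ℝ)}))
  have hgi : Integrable g (μ.map D) := by
    rw [integrable_map_measure (measurable_of_countable g).aestronglyMeasurable hD.aemeasurable,
      ← hgD]
    exact hInt.indicator hS
  have hsum : Summable fun n => (μ.map D).real {n} • g n := by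
    rw [← Measure.sum_smul_dirac (μ.map D)] at hgi
    simpa [integral_smul_measure, measureReal_def] using (hasSum_integral_measure hgi).summable
  have key : ∫ ω, g (D ω) ∂μ = ∑' n, (μ.map D).real {n} • g n := by
    rw [← integral_countable hgi,
      integral_map hD.aemeasurable (measurable_of_countable g).aestronglyMeasurable]
  have h0 : g 0 = 0 := by
    have : ¬ x + 1 < 0 := by linarith
    simp [hg]
  rw [hgD]
  simp only [Function.comp_apply]
  rw [key, hsum.tsum_eq_zero_add, h0, smul_zero, zero_add, ← tsum_div_const]
  refine tsum_congr fun j => ?_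
  have hm : (μ.map D).real {j + 1} = (μ {ω | D ω = j + 1}).toReal := by
    rw [measureReal_def, Measure.map_apply hD (measurableSet_singleton _)]
    rfl
  rw [hm]
  by_cases h : x < (j : ℝ)
  · simp [hg, h, mul_comm]
  · simp [hg, h]

/-- Dyadic decomposition of the part of `y` above a positive level `x`. -/
lemma ofReal_le_tsum_dyadic_indicator (x y : ℝ) (hx : 0 < x) (hxy : x < y) :
    ENNReal.ofReal y ≤
      ∑' k : ℕ, if 2 ^ k * x < y then ENNReal.ofReal (2 ^ (k + 1) * x) else 0 := by
  have hex : ∃ n : ℕ, y ≤ 2 ^ n * x := by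
    obtain ⟨n, hn⟩ := pow_unbounded_of_one_lt (y / x) (one_lt_two (α := ℝ))
    exact ⟨n, ((div_lt_iff₀ hx).1 hn).le⟩
  classical
  obtain ⟨k, hk⟩ : ∃ k, Nat.find hex = k + 1 := by
    refine Nat.exists_eq_succ_of_ne_zero fun h => ?_
    have := Nat.find_spec hex
    rw [h] at this
    simp at this
    linarith
  have h1 : y ≤ 2 ^ (k + 1) * x := hk ▸ Nat.find_spec hex
  have h2 : 2 ^ k * x < y := not_le.1 (Nat.find_min hex (by omega))
  refine le_trans ?_ (ENNReal.le_tsum k)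
  rw [if_pos h2]
  exact ENNReal.ofReal_le_ofReal h1

/-- A random variable whose tail is `O(x ^ (-(s + 1)))` with `s > 0` has truncated expectation
`O(x ^ (-s))`. -/
lemma integral_indicator_le_of_tail_le
    {Ω : Type*} [MeasurableSpace Ω] (μ : Measure Ω) [IsFiniteMeasure μ]
    (X : Ω → ℝ) (hX : Measurable X) (s C : ℝ) (hs : 0 < s) (hC : 0 ≤ C)
    (htail : ∀ x : ℝ, 1 ≤ x → μ.real {ω | x < X ω} ≤ C * x ^ (-(s + 1))) (x : ℝ) (hx : 1 ≤ x) :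
    ∫ ω, {ω | x < X ω}.indicator X ω ∂μ ≤ 2 * C * (1 - 2 ^ (-s))⁻¹ * x ^ (-s) := by
  have hx0 : 0 < x := by linarith
  set r : ℝ := 2 ^ (-s) with hr
  have hr0 : 0 < r := by positivity
  have hr1 : r < 1 := Real.rpow_lt_one_of_one_lt_of_neg one_lt_two (by linarith)
  have hr1' : 0 < 1 - r := by linarith
  have hmeas (y : ℝ) : MeasurableSet {ω | y < X ω} := measurableSet_lt measurable_const hX
  have hnn : 0 ≤ {ω | x < X ω}.indicator X := by
    refine Set.indicator_nonneg fun ω hω => ?_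
    exact (hx0.trans hω).le
  rw [integral_eq_lintegral_of_nonneg_ae (.of_forall hnn)
    (hX.indicator (hmeas x)).aestronglyMeasurable]
  refine ENNReal.toReal_le_of_le_ofReal (by positivity) ?_
  calc ∫⁻ ω, ENNReal.ofReal ({ω | x < X ω}.indicator X ω) ∂μ
      ≤ ∫⁻ ω, ∑' k : ℕ, {ω | 2 ^ k * x < X ω}.indicator
          (fun _ => ENNReal.ofReal (2 ^ (k + 1) * x)) ω ∂μ := by
        refine lintegral_mono fun ω => ?_
        by_cases h : x < X ω
        · simpa [Set.indicator_apply, h] using ofReal_le_tsum_dyadic_indicator x (X ω) hx0 h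
        · simp [h]
    _ = ∑' k : ℕ, ENNReal.ofReal (2 ^ (k + 1) * x) * μ {ω | 2 ^ k * x < X ω} := by
        rw [lintegral_tsum fun k => (measurable_const.indicator (hmeas _)).aemeasurable]
        exact tsum_congr fun k => lintegral_indicator_const (hmeas _) _
    _ ≤ ∑' k : ℕ, ENNReal.ofReal (2 * C * x ^ (-s) * r ^ k) := by
        refine ENNReal.tsum_le_tsum fun k => ?_
        have h2k : (1 : ℝ) ≤ 2 ^ k := one_le_pow₀ one_le_two
        have hy : 1 ≤ 2 ^ k * x := one_le_mul_of_one_le_of_one_le h2k hx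
        have hy0 : 0 < 2 ^ k * x := by positivity
        rw [← ofReal_measureReal, ← ENNReal.ofReal_mul (by positivity)]
        refine ENNReal.ofReal_le_ofReal ?_
        have hp : (2 ^ k * x) * (2 ^ k * x) ^ (-(s + 1)) = r ^ k * x ^ (-s) := by
          rw [← Real.rpow_one_add' hy0.le (by linarith), show 1 + -(s + 1) = -s by ring,
            Real.mul_rpow (by positivity) hx0.le, hr, ← Real.rpow_natCast 2 k,
            ← Real.rpow_natCast _ k, ← Real.rpow_mul (by norm_num),
            ← Real.rpow_mul (by norm_num), mul_comm (k : ℝ)]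
        calc 2 ^ (k + 1) * x * μ.real {ω | 2 ^ k * x < X ω}
            ≤ 2 ^ (k + 1) * x * (C * (2 ^ k * x) ^ (-(s + 1))) := by
              gcongr
              exact htail _ hy
          _ = 2 * C * ((2 ^ k * x) * (2 ^ k * x) ^ (-(s + 1))) := by ring
          _ = 2 * C * x ^ (-s) * r ^ k := by rw [hp]; ring
    _ = ENNReal.ofReal (2 * C * (1 - r)⁻¹ * x ^ (-s)) := by
        rw [← ENNReal.ofReal_tsum_of_nonneg (fun k => by positivity)
          ((summable_geometric_of_lt_one hr0.le hr1).mul_left _), tsum_mul_left,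
          tsum_geometric_of_lt_one hr0.le hr1]
        congr 1
        ring

/-- the tail of the pmf `f*_j = (j+1)·P(D = j+1)/E[D]` of (the size-biased
version of `D`) minus one is a power law with exponent `τ - 2`. -/
theorem size_biased_tail
    {Ω : Type*} [MeasurableSpace Ω] (μ : Measure Ω) [IsProbabilityMeasure μ]
    (τ : ℝ) (hτ1 : 2 < τ) (hτ2 : τ < 3)
    (D : Ω → ℕ) (hD : Measurable D)
    (hD2 : μ {ω | 2 ≤ D ω} = 1)
    (hInt : Integrable (fun ω => (D ω : ℝ)) μ)
    (hmean : 0 < ∫ ω, (D ω : ℝ) ∂μ)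
    (c₁ C₁ : ℝ) (hc₁ : 0 < c₁) (hc₁C₁ : c₁ ≤ C₁)
    (htail_lb : ∀ x : ℝ, 1 ≤ x → c₁ * x ^ (-(τ - 1)) ≤ (μ {ω | x < (D ω : ℝ)}).toReal)
    (htail_ub : ∀ x : ℝ, 1 ≤ x → (μ {ω | x < (D ω : ℝ)}).toReal ≤ C₁ * x ^ (-(τ - 1))) :
    ∃ c₁s C₁s : ℝ, 0 < c₁s ∧ c₁s ≤ C₁s ∧
      ∀ x : ℝ, 1 ≤ x →
        c₁s * x ^ (-(τ - 2)) ≤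
          (∑' j : ℕ, if x < (j : ℝ) then
              ((j : ℝ) + 1) * (μ {ω | D ω = j + 1}).toReal / (∫ ω, (D ω : ℝ) ∂μ)
            else 0) ∧
        (∑' j : ℕ, if x < (j : ℝ) then
              ((j : ℝ) + 1) * (μ {ω | D ω = j + 1}).toReal / (∫ ω, (D ω : ℝ) ∂μ)
            else 0) ≤ C₁s * x ^ (-(τ - 2)) := by
  set m : ℝ := ∫ ω, (D ω : ℝ) ∂μ with hm
  have hs : 0 < τ - 2 := by linarith
  have hC : 0 < C₁ := hc₁.trans_le hc₁C₁
  have hDr : Measurable fun ω => (D ω : ℝ) := measurable_from_nat.comp hD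
  have hmeas (y : ℝ) : MeasurableSet {ω | y < (D ω : ℝ)} := measurableSet_lt measurable_const hDr
  have hr1 : (2 : ℝ) ^ (-(τ - 2)) < 1 :=
    Real.rpow_lt_one_of_one_lt_of_neg one_lt_two (by linarith)
  have hr1' : 0 < 1 - (2 : ℝ) ^ (-(τ - 2)) := by linarith
  have hexp : τ - 2 + 1 = τ - 1 := by ring
  have hlow (x : ℝ) (hx : 1 ≤ x) : c₁ * 2 ^ (-(τ - 2)) / m * x ^ (-(τ - 2)) ≤
      (∫ ω, {ω | x + 1 < (D ω : ℝ)}.indicator (fun ω => (D ω : ℝ)) ω ∂μ) / m := by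
    rw [div_mul_eq_mul_div]
    gcongr
    calc c₁ * 2 ^ (-(τ - 2)) * x ^ (-(τ - 2))
        = c₁ * (2 * x) ^ (-(τ - 2)) := by
          rw [Real.mul_rpow zero_le_two (by linarith), mul_assoc]
      _ ≤ c₁ * (x + 1) ^ (-(τ - 2)) := by
          gcongr c₁ * ?_
          exact Real.rpow_le_rpow_of_nonpos (by linarith) (by linarith) (by linarith)
      _ = (x + 1) * (c₁ * (x + 1) ^ (-(τ - 1))) := by
          rw [show -(τ - 2) = 1 + -(τ - 1) by ring,
            Real.rpow_one_add' (by linarith) (by linarith)]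
          ring
      _ ≤ (x + 1) * μ.real {ω | x + 1 < (D ω : ℝ)} := by
          gcongr
          exact htail_lb _ (by linarith)
      _ = ∫ ω, {ω | x + 1 < (D ω : ℝ)}.indicator (fun _ => x + 1) ω ∂μ := by
          rw [integral_indicator_const _ (hmeas _), smul_eq_mul, mul_comm]
      _ ≤ ∫ ω, {ω | x + 1 < (D ω : ℝ)}.indicator (fun ω => (D ω : ℝ)) ω ∂μ := by
          refine integral_mono ((integrable_const _).indicator (hmeas _))
            (hInt.indicator (hmeas _)) fun ω => ?_
          exact Set.indicator_le_indicator' fun h => le_of_lt h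
  have hup (x : ℝ) (hx : 1 ≤ x) :
      (∫ ω, {ω | x + 1 < (D ω : ℝ)}.indicator (fun ω => (D ω : ℝ)) ω ∂μ) / m ≤
        2 * C₁ * (1 - 2 ^ (-(τ - 2)))⁻¹ / m * x ^ (-(τ - 2)) := by
    rw [div_mul_eq_mul_div]
    gcongr
    refine (integral_indicator_le_of_tail_le μ _ hDr (τ - 2) C₁ hs hC.le
      (by rw [hexp]; exact htail_ub) (x + 1) (by linarith)).trans ?_
    gcongr _ * ?_
    exact Real.rpow_le_rpow_of_nonpos (by linarith) (by linarith) (by linarith)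
  refine ⟨c₁ * 2 ^ (-(τ - 2)) / m, 2 * C₁ * (1 - 2 ^ (-(τ - 2)))⁻¹ / m, by positivity, ?_,
    fun x hx => ?_⟩
  · simpa using (hlow 1 le_rfl).trans (hup 1 le_rfl)
  · rw [tsum_succ_mul_measure_eq_integral μ D hD hInt m x (by linarith)]
    exact ⟨hlow x hx, hup x hx⟩
end

section
/- Let τ be a real number with 2 < τ < 3 and let X be an ℕ-valued random variable with constants 0 < c* ≤ C* < ∞ such that c*·x^{-(τ-2)} ≤ P(X > x) ≤ C*·x^{-(τ-2)} for all real x ≥ 1. Then there exist constants 0 < c' ≤ C' < ∞ such that for all s ∈ [1/2, 1), c'·(1-s)^{τ-2} ≤ 1 - E[s^X] ≤ C'·(1-s)^{τ-2}. -/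
open MeasureTheory

theorem one_sub_pow_nonneg_of_mem {s : ℝ} (hs0 : 0 ≤ s) (hs1 : s ≤ 1) (n : ℕ) :
    0 ≤ 1 - s ^ n :=
  sub_nonneg.2 (pow_le_one₀ hs0 hs1)

theorem integrable_pow_natCast_of_mem
    {Ω : Type*} [MeasurableSpace Ω] (μ : Measure Ω) [IsProbabilityMeasure μ]
    {X : Ω → ℕ} (hX : Measurable X) {s : ℝ} (hs0 : 0 ≤ s) (hs1 : s ≤ 1) :
    Integrable (fun ω => s ^ X ω) μ := by
  refine Integrable.of_bound (C := 1)
    ((measurable_from_nat (f := fun n : ℕ => s ^ n)).comp hX).aestronglyMeasurable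
    (Filter.Eventually.of_forall fun ω => ?_)
  rw [Real.norm_of_nonneg (pow_nonneg hs0 _)]
  exact pow_le_one₀ hs0 hs1

theorem one_sub_integral_pow
    {Ω : Type*} [MeasurableSpace Ω] (μ : Measure Ω) [IsProbabilityMeasure μ]
    {X : Ω → ℕ} (hX : Measurable X) {s : ℝ} (hs0 : 0 ≤ s) (hs1 : s ≤ 1) :
    1 - ∫ ω, s ^ X ω ∂μ = ∫ ω, (1 - s ^ X ω) ∂μ := by
  rw [integral_sub (integrable_const _) (integrable_pow_natCast_of_mem μ hX hs0 hs1)]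
  simp

theorem mul_measure_tail_le_one_sub_integral_pow
    {Ω : Type*} [MeasurableSpace Ω] (μ : Measure Ω) [IsProbabilityMeasure μ]
    {X : Ω → ℕ} (hX : Measurable X) {s : ℝ} (hs0 : 0 ≤ s) (hs1 : s < 1) :
    (1 - Real.exp (-1)) * μ.real {ω | (1 - s)⁻¹ < (X ω : ℝ)} ≤ 1 - ∫ ω, s ^ X ω ∂μ := by
  have hu : 0 < 1 - s := sub_pos.2 hs1
  have he : 0 ≤ 1 - Real.exp (-1) := sub_nonneg.2 (Real.exp_le_one_iff.2 (by norm_num))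
  rw [one_sub_integral_pow μ hX hs0 hs1.le]
  refine le_trans (mul_le_mul_of_nonneg_left (measureReal_mono ?_) he)
    (mul_meas_ge_le_integral_of_nonneg
      (Filter.Eventually.of_forall fun ω => one_sub_pow_nonneg_of_mem hs0 hs1.le (X ω))
      ((integrable_const _).sub (integrable_pow_natCast_of_mem μ hX hs0 hs1.le)) _)
  intro ω hω
  simp only [Set.mem_ofPred_eq] at hω ⊢
  have h1 : 1 ≤ (X ω : ℝ) * (1 - s) := by
    rw [inv_lt_iff_one_lt_mul₀ hu] at hω
    linarith
  have h2 : s ^ X ω ≤ Real.exp (-1) :=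
    calc s ^ X ω ≤ Real.exp (s - 1) ^ X ω :=
          pow_le_pow_left₀ hs0 (by linarith [Real.add_one_le_exp (s - 1)]) _
      _ = Real.exp (X ω * (s - 1)) := (Real.exp_nat_mul _ _).symm
      _ ≤ Real.exp (-1) := Real.exp_le_exp.2 (by linarith)
  linarith

theorem one_sub_integral_pow_le_of_tail_le
    {Ω : Type*} [MeasurableSpace Ω] (μ : Measure Ω) [IsProbabilityMeasure μ]
    {X : Ω → ℕ} (hX : Measurable X) {α K : ℝ} (hα : α < 1)
    (htail : ∀ x : ℝ, 0 < x → μ.real {ω | x < (X ω : ℝ)} ≤ K * x ^ (-α))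
    {s : ℝ} (hs0 : 0 ≤ s) (hs1 : s < 1) :
    1 - ∫ ω, s ^ X ω ∂μ ≤ K / (1 - α) * (1 - s) ^ α := by
  have hu : 0 < 1 - s := sub_pos.2 hs1
  have hint : IntervalIntegrable (fun t : ℝ => t ^ (-α)) volume 0 1 :=
    intervalIntegral.intervalIntegrable_rpow' (by linarith)
  have hf : Integrable (fun ω => 1 - s ^ X ω) μ :=
    (integrable_const _).sub (integrable_pow_natCast_of_mem μ hX hs0 hs1.le)
  rw [one_sub_integral_pow μ hX hs0 hs1.le, hf.integral_eq_integral_meas_lt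
      (Filter.Eventually.of_forall fun ω => one_sub_pow_nonneg_of_mem hs0 hs1.le (X ω))]
  calc ∫ t in Set.Ioi 0, μ.real {ω | t < 1 - s ^ X ω}
      ≤ ∫ t in Set.Ioi 0,
          (Set.Ioc (0 : ℝ) 1).indicator (fun t => K * (1 - s) ^ α * t ^ (-α)) t := by
        refine integral_mono_of_nonneg
          (Filter.Eventually.of_forall fun t => measureReal_nonneg) ?_ ?_
        · refine ((integrable_indicator_iff measurableSet_Ioc).2 ?_).integrableOn
          exact ((intervalIntegrable_iff_integrableOn_Ioc_of_le zero_le_one).1 hint).const_mul _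
        · filter_upwards [ae_restrict_mem measurableSet_Ioi] with t (ht : 0 < t)
          by_cases h1 : t ≤ 1
          · rw [Set.indicator_of_mem (Set.mem_Ioc.2 ⟨ht, h1⟩)]
            calc μ.real {ω | t < 1 - s ^ X ω}
                ≤ μ.real {ω | t / (1 - s) < (X ω : ℝ)} := by
                  refine measureReal_mono fun ω hω => ?_
                  simp only [Set.mem_ofPred_eq] at hω ⊢
                  rw [div_lt_iff₀ hu]
                  have := one_add_mul_le_pow (a := s - 1) (by linarith) (X ω)
                  rw [add_sub_cancel] at this
                  linarith
              _ ≤ K * (t / (1 - s)) ^ (-α) := htail _ (div_pos ht hu)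
              _ = K * (1 - s) ^ α * t ^ (-α) := by
                  rw [Real.div_rpow ht.le hu.le, Real.rpow_neg hu.le, div_inv_eq_mul]
                  ring
          · rw [Set.indicator_of_notMem fun h => h1 h.2]
            have : {ω | t < 1 - s ^ X ω} = ∅ := by
              refine Set.eq_empty_of_forall_notMem fun ω hω => ?_
              simp only [Set.mem_ofPred_eq] at hω
              linarith [pow_nonneg hs0 (X ω)]
            simp [this]
    _ = ∫ t in (0 : ℝ)..1, K * (1 - s) ^ α * t ^ (-α) := by
        rw [setIntegral_indicator measurableSet_Ioc,
          Set.inter_eq_right.2 Set.Ioc_subset_Ioi_self,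
          intervalIntegral.integral_of_le zero_le_one]
    _ = K / (1 - α) * (1 - s) ^ α := by
        rw [intervalIntegral.integral_const_mul, integral_rpow (Or.inl (by linarith)),
          Real.one_rpow, Real.zero_rpow (by linarith), neg_add_eq_sub]
        ring

/-- for a size-biased power-law variable `X` with exponent `τ-2`, the
generating function satisfies `1 - E[s^X] ≍ (1-s)^{τ-2}` on `[1/2, 1)`. -/
theorem pgf_one_minus_two_sided
    {Ω : Type*} [MeasurableSpace Ω] (μ : Measure Ω) [IsProbabilityMeasure μ]
    (τ : ℝ) (hτ1 : 2 < τ) (hτ2 : τ < 3)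
    (X : Ω → ℕ) (hX : Measurable X)
    (cs Cs : ℝ) (hcs : 0 < cs) (hcsCs : cs ≤ Cs)
    (htail_lb : ∀ x : ℝ, 1 ≤ x → cs * x ^ (-(τ - 2)) ≤ (μ {ω | x < (X ω : ℝ)}).toReal)
    (htail_ub : ∀ x : ℝ, 1 ≤ x → (μ {ω | x < (X ω : ℝ)}).toReal ≤ Cs * x ^ (-(τ - 2))) :
    ∃ c' C' : ℝ, 0 < c' ∧ c' ≤ C' ∧
      ∀ s : ℝ, 1 / 2 ≤ s → s < 1 →
        c' * (1 - s) ^ (τ - 2) ≤ 1 - ∫ ω, s ^ X ω ∂μ ∧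
        1 - ∫ ω, s ^ X ω ∂μ ≤ C' * (1 - s) ^ (τ - 2) := by
  have he : 0 < 1 - Real.exp (-1) := sub_pos.2 (Real.exp_lt_one_iff.2 (by norm_num))
  have hc : 0 < (1 - Real.exp (-1)) * cs := mul_pos he hcs
  have htail : ∀ x : ℝ, 0 < x →
      μ.real {ω | x < (X ω : ℝ)} ≤ max 1 Cs * x ^ (-(τ - 2)) := by
    intro x hx
    rcases le_total 1 x with h | h
    · exact (htail_ub x h).trans
        (mul_le_mul_of_nonneg_right (le_max_right _ _) (Real.rpow_nonneg hx.le _))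
    · exact measureReal_le_one.trans (one_le_mul_of_one_le_of_one_le (le_max_left _ _)
        (Real.one_le_rpow_of_pos_of_le_one_of_nonpos hx h (by linarith)))
  refine ⟨(1 - Real.exp (-1)) * cs,
    max ((1 - Real.exp (-1)) * cs) (max 1 Cs / (1 - (τ - 2))), hc, le_max_left _ _, ?_⟩
  intro s hs hs1
  have hu : 0 < 1 - s := sub_pos.2 hs1
  have hs0 : 0 ≤ s := by linarith
  constructor
  · refine le_trans ?_ (mul_measure_tail_le_one_sub_integral_pow μ hX hs0 hs1)
    have h := htail_lb (1 - s)⁻¹ ((one_le_inv₀ hu).2 (by linarith))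
    rw [Real.inv_rpow hu.le, Real.rpow_neg hu.le, inv_inv] at h
    rw [mul_assoc]
    exact mul_le_mul_of_nonneg_left h he.le
  · exact (one_sub_integral_pow_le_of_tail_le μ hX (by linarith) htail hs0 hs1).trans
      (mul_le_mul_of_nonneg_right (le_max_right _ _) (Real.rpow_nonneg hu.le _))
end

section
/- Let τ be a real number with 2 < τ < 3 and let X be an ℕ-valued random variable with constants 0 < c* ≤ C* < ∞ such that c*·x^{-(τ-2)} ≤ P(X > x) ≤ C*·x^{-(τ-2)} for all real x ≥ 1. Then there exist constants c₂ > 0 and A ≥ 1, depending only on τ, c* and C*, such that for every integer Q ≥ A and every real s ∈ (0, 1/2] with s^{τ-2} ≥ A·Q^{2-τ}, one has P(X < Q) > 0 and E[ 1 - (1-s)^X | X < Q ] ≥ c₂·s^{τ-2}. -/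
open MeasureTheory ProbabilityTheory

/-- If `1 < s * n`, at least one of `n` independent trials of success probability `s` succeeds
with probability at least one half. -/
theorem half_le_one_sub_one_sub_pow {s : ℝ} {n : ℕ} (hs : s ≤ 1) (hn : 1 < s * n) :
    1 / 2 ≤ 1 - (1 - s) ^ n := by
  have hpow : (1 - s) ^ n ≤ Real.exp (-1) := by
    calc (1 - s) ^ n ≤ Real.exp (-s) ^ n :=
          pow_le_pow_left₀ (by linarith) (by linarith [Real.add_one_le_exp (-s)]) n
      _ = Real.exp (-(s * n)) := by rw [← Real.exp_nat_mul]; ring_nf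
      _ ≤ Real.exp (-1) := Real.exp_le_exp.2 (by linarith)
  linarith [Real.exp_neg_one_lt_half]

/-- Conditioning a probability measure on `B` does not decrease the measure of `B ∩ E`. -/
theorem measureReal_inter_le_cond {Ω : Type*} [MeasurableSpace Ω] (μ : Measure Ω)
    [IsProbabilityMeasure μ] {B : Set Ω} (hB : MeasurableSet B) (E : Set Ω) :
    μ.real (B ∩ E) ≤ (μ[|B]).real E := by
  rw [measureReal_def (μ[|B]), cond_apply hB, ENNReal.toReal_mul, ENNReal.toReal_inv,
    ← measureReal_def, ← measureReal_def]
  rcases eq_or_ne (μ.real B) 0 with h0 | h0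
  · have : μ.real (B ∩ E) ≤ μ.real B := measureReal_mono Set.inter_subset_left
    simp [h0] at this ⊢
    exact this
  · exact le_mul_of_one_le_left measureReal_nonneg
      ((one_le_inv₀ (lt_of_le_of_ne measureReal_nonneg h0.symm)).2 measureReal_le_one)

/-- Under two-sided power-law tail bounds, the truncated event `1 / s < X < Q` still has
probability of order `s ^ a`, provided `s ^ a` dominates `Q ^ (-a)`. -/
theorem truncated_tail_lower {a cs Cs : ℝ} (ha0 : 0 < a) (ha1 : a < 1) (hcs : 0 < cs)
    (hCs : 0 < Cs) {Ω : Type*} [MeasurableSpace Ω] (μ : Measure Ω) [IsProbabilityMeasure μ]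
    (X : Ω → ℕ)
    (hlow : ∀ x : ℝ, 1 ≤ x → cs * x ^ (-a) ≤ μ.real {ω | x < (X ω : ℝ)})
    (hup : ∀ x : ℝ, 1 ≤ x → μ.real {ω | x < (X ω : ℝ)} ≤ Cs * x ^ (-a))
    {Q : ℕ} (hQ : (2 : ℝ) ≤ Q) {s : ℝ} (hs0 : 0 < s) (hs1 : s ≤ 1)
    (hs : 4 * Cs / cs * (Q : ℝ) ^ (-a) ≤ s ^ a) :
    cs / 2 * s ^ a ≤ μ.real ({ω | X ω < Q} ∩ {ω | 1 / s < (X ω : ℝ)}) := by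
  have hl : cs * s ^ a ≤ μ.real {ω | 1 / s < (X ω : ℝ)} := by
    have h := hlow (1 / s) ((one_le_div hs0).2 hs1)
    rwa [one_div, Real.rpow_neg (inv_nonneg.2 hs0.le), Real.inv_rpow hs0.le, inv_inv,
      ← one_div] at h
  have hhalf : ((Q : ℝ) / 2) ^ (-a) ≤ 2 * (Q : ℝ) ^ (-a) := by
    have h2 : (2 : ℝ) ^ a ≤ 2 := by
      simpa using Real.rpow_le_rpow_of_exponent_le (x := 2) (by norm_num) ha1.le
    rw [Real.div_rpow (by linarith) (by norm_num), Real.rpow_neg (x := 2) (by norm_num),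
      div_inv_eq_mul, mul_comm]
    exact mul_le_mul_of_nonneg_right h2 (Real.rpow_nonneg (by linarith) _)
  have hu : μ.real {ω | (Q : ℝ) / 2 < (X ω : ℝ)} ≤ cs / 2 * s ^ a := by
    calc _ ≤ Cs * ((Q : ℝ) / 2) ^ (-a) := hup _ (by linarith)
      _ ≤ Cs * (2 * (Q : ℝ) ^ (-a)) := mul_le_mul_of_nonneg_left hhalf hCs.le
      _ = cs / 2 * (4 * Cs / cs * (Q : ℝ) ^ (-a)) := by field_simp; ring
      _ ≤ cs / 2 * s ^ a := mul_le_mul_of_nonneg_left hs (by linarith)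
  have hsub : {ω | 1 / s < (X ω : ℝ)} ⊆
      ({ω | X ω < Q} ∩ {ω | 1 / s < (X ω : ℝ)}) ∪ {ω | (Q : ℝ) / 2 < (X ω : ℝ)} := by
    intro ω hω
    rcases lt_or_ge (X ω) Q with h | h
    · exact Or.inl ⟨h, hω⟩
    · have h' : (Q : ℝ) ≤ X ω := by exact_mod_cast h
      exact Or.inr (show (Q : ℝ) / 2 < X ω by linarith)
  have := (measureReal_mono (μ := μ) hsub).trans (measureReal_union_le _ _)
  linarith

/-- a vertex whose degree is conditioned to lie below the truncation level
`Q` has at least one blue child (each child independently blue with probability `s`)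
with probability at least `c₂ · s^{τ-2}`. -/
theorem truncated_blue_child_lower
    (τ : ℝ) (hτ1 : 2 < τ) (hτ2 : τ < 3)
    (cs Cs : ℝ) (hcs : 0 < cs) (hcsCs : cs ≤ Cs) :
    ∃ c₂ : ℝ, 0 < c₂ ∧ ∃ A : ℝ, 1 ≤ A ∧
      ∀ (Ω : Type) [MeasurableSpace Ω] (μ : Measure Ω) [IsProbabilityMeasure μ],
      ∀ (X : Ω → ℕ), Measurable X →
        (∀ x : ℝ, 1 ≤ x → cs * x ^ (-(τ - 2)) ≤ (μ {ω | x < (X ω : ℝ)}).toReal) →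
        (∀ x : ℝ, 1 ≤ x → (μ {ω | x < (X ω : ℝ)}).toReal ≤ Cs * x ^ (-(τ - 2))) →
        ∀ Q : ℕ, A ≤ (Q : ℝ) →
        ∀ s : ℝ, 0 < s → s ≤ 1 / 2 → A * (Q : ℝ) ^ (2 - τ) ≤ s ^ (τ - 2) →
          0 < (μ {ω | X ω < Q}).toReal ∧
          c₂ * s ^ (τ - 2) ≤ ∫ ω, (1 - (1 - s) ^ X ω) ∂(μ[|{ω | X ω < Q}]) := by
  refine ⟨cs / 4, by positivity, 4 * Cs / cs, ?_, ?_⟩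
  · rw [one_le_div hcs]; linarith
  intro Ω _ μ _ X hX hlow hup Q hQ s hs0 hs2 hs
  have hQ2 : (2 : ℝ) ≤ Q := by
    refine le_trans ?_ hQ
    rw [le_div_iff₀ hcs]; linarith
  have hspow : 0 < s ^ (τ - 2) := Real.rpow_pos_of_pos hs0 _
  have hmass : cs / 2 * s ^ (τ - 2) ≤ μ.real ({ω | X ω < Q} ∩ {ω | 1 / s < (X ω : ℝ)}) :=
    truncated_tail_lower (by linarith) (by linarith) hcs (by linarith) μ X hlow hup hQ2 hs0
      (by linarith) (by rwa [neg_sub])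
  have hB : MeasurableSet {ω | X ω < Q} := measurableSet_lt hX measurable_const
  have hBpos : 0 < μ.real {ω | X ω < Q} :=
    (mul_pos (half_pos hcs) hspow).trans_le
      (hmass.trans (measureReal_mono Set.inter_subset_left))
  refine ⟨hBpos, ?_⟩
  have : IsProbabilityMeasure (μ[|{ω | X ω < Q}]) :=
    cond_isProbabilityMeasure fun h => by simp [Measure.real, h] at hBpos
  have hpow0 (n : ℕ) : 0 ≤ (1 - s) ^ n := pow_nonneg (by linarith) n
  have hpow1 (n : ℕ) : (1 - s) ^ n ≤ 1 := pow_le_one₀ (by linarith) (by linarith)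
  have hint : Integrable (fun ω => 1 - (1 - s) ^ X ω) (μ[|{ω | X ω < Q}]) := by
    refine Integrable.of_bound (C := 1)
      ((measurable_of_countable fun n : ℕ => 1 - (1 - s) ^ n).comp hX).aestronglyMeasurable
      (Filter.Eventually.of_forall fun ω => ?_)
    rw [Real.norm_eq_abs, abs_le]
    constructor <;> linarith [hpow0 (X ω), hpow1 (X ω)]
  have hmarkov := mul_meas_ge_le_integral_of_nonneg
    (Filter.Eventually.of_forall fun ω => sub_nonneg.2 (hpow1 (X ω))) hint (1 / 2)
  have hsub : {ω | 1 / s < (X ω : ℝ)} ⊆ {ω | 1 / 2 ≤ 1 - (1 - s) ^ X ω} := fun ω hω =>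
    half_le_one_sub_one_sub_pow (by linarith) ((div_lt_iff₀' hs0).1 hω)
  have hcond := hmass.trans ((measureReal_inter_le_cond μ hB _).trans (measureReal_mono hsub))
  linarith
end

section
/- Let τ be a real number with 2 < τ < 3 and let b_r, b_b ∈ [0,1) be real numbers. Then for every integer ℓ (positive, zero, or negative), (τ-2)^{b_r+ℓ} + (τ-2)^{b_b-ℓ-1} > τ - 1. -/
/-- no choice of the split generation `ℓ` makes
`(τ-2)^{b_r+ℓ} + (τ-2)^{b_b-ℓ-1}` drop to `τ-1` or below. -/
theorem no_connection_at_distance_plus_three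
    (τ : ℝ) (hτ1 : 2 < τ) (hτ2 : τ < 3)
    (br bb : ℝ) (hbr0 : 0 ≤ br) (hbr1 : br < 1) (hbb0 : 0 ≤ bb) (hbb1 : bb < 1) :
    ∀ ℓ : ℤ,
      τ - 1 < (τ - 2) ^ (br + (ℓ : ℝ)) + (τ - 2) ^ (bb - (ℓ : ℝ) - 1) := by
  intro ℓ
  have hx0 : 0 < τ - 2 := by linarith
  have hx1 : τ - 2 < 1 := by linarith
  have hu : (τ - 2) ^ ((ℓ : ℝ) + 1) < (τ - 2) ^ (br + (ℓ : ℝ)) :=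
    Real.rpow_lt_rpow_of_exponent_gt hx0 hx1 (by linarith)
  have hv : (τ - 2) ^ (-(ℓ : ℝ)) < (τ - 2) ^ (bb - (ℓ : ℝ) - 1) :=
    Real.rpow_lt_rpow_of_exponent_gt hx0 hx1 (by linarith)
  have huv : (τ - 2) ^ ((ℓ : ℝ) + 1) * (τ - 2) ^ (-(ℓ : ℝ)) = τ - 2 := by
    rw [← Real.rpow_add hx0, show (ℓ : ℝ) + 1 + -(ℓ : ℝ) = 1 by ring, Real.rpow_one]
  rcases le_or_gt 0 ℓ with h | h
  · have h' : (0 : ℝ) ≤ ℓ := by exact_mod_cast h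
    have hu1 : (τ - 2) ^ ((ℓ : ℝ) + 1) ≤ 1 :=
      Real.rpow_le_one hx0.le hx1.le (by linarith)
    have hv1 : 1 ≤ (τ - 2) ^ (-(ℓ : ℝ)) :=
      Real.one_le_rpow_of_pos_of_le_one_of_nonpos hx0 hx1.le (by linarith)
    nlinarith [mul_nonneg (sub_nonneg.2 hu1) (sub_nonneg.2 hv1)]
  · have h' : (ℓ : ℝ) + 1 ≤ 0 := by exact_mod_cast h
    have hu1 : 1 ≤ (τ - 2) ^ ((ℓ : ℝ) + 1) :=
      Real.one_le_rpow_of_pos_of_le_one_of_nonpos hx0 hx1.le h'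
    have hv1 : (τ - 2) ^ (-(ℓ : ℝ)) ≤ 1 :=
      Real.rpow_le_one hx0.le hx1.le (by linarith)
    nlinarith [mul_nonneg (sub_nonneg.2 hu1) (sub_nonneg.2 hv1)]
end

section
/- Let τ be a real number with 2 < τ < 3 and let b_r, b_b ∈ [0,1) be real numbers. Set g = 1 + b_r + b_b - 1{ τ-1 > (τ-2)^{b_r} + (τ-2)^{b_b} }, where 1{·} is the indicator. Then 2·log(2/(τ-1))/|log(τ-2)| ≤ g < 2. -/
/-- Weighted AM-GM for two powers of the same base. -/
theorem two_mul_rpow_half_add_le {a : ℝ} (ha : 0 < a) (x y : ℝ) :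
    2 * a ^ ((x + y) / 2) ≤ a ^ x + a ^ y := by
  have hx : a ^ x = (a ^ (x / 2)) ^ 2 := by
    rw [← Real.rpow_mul_natCast ha.le]; congr 1; push_cast; ring
  have hy : a ^ y = (a ^ (y / 2)) ^ 2 := by
    rw [← Real.rpow_mul_natCast ha.le]; congr 1; push_cast; ring
  rw [add_div, Real.rpow_add ha, hx, hy]
  nlinarith [sq_nonneg (a ^ (x / 2) - a ^ (y / 2))]

/-- If `1 + a ≤ a ^ x + a ^ y` with exponents in `[0, 1)` then `x + y < 1`. -/
theorem add_lt_one_of_one_add_le_rpow_add_rpow {a x y : ℝ} (ha0 : 0 < a) (ha1 : a < 1)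
    (hx0 : 0 ≤ x) (hx1 : x < 1) (hy0 : 0 ≤ y) (hy1 : y < 1)
    (h : 1 + a ≤ a ^ x + a ^ y) : x + y < 1 := by
  rw [← Real.rpow_lt_rpow_left_iff_of_base_lt_one ha0 ha1, Real.rpow_one, Real.rpow_add ha0]
  have hxa : a < a ^ x := by
    simpa using Real.rpow_lt_rpow_of_exponent_gt ha0 ha1 hx1
  have hya : a < a ^ y := by
    simpa using Real.rpow_lt_rpow_of_exponent_gt ha0 ha1 hy1
  have hx : a ^ x ≤ 1 := Real.rpow_le_one ha0.le ha1.le hx0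
  have hy : a ^ y ≤ 1 := Real.rpow_le_one ha0.le ha1.le hy0
  rcases hx.eq_or_lt with hx | hx
  · rwa [hx, one_mul]
  rcases hy.eq_or_lt with hy | hy
  · rwa [hy, mul_one]
  nlinarith [mul_pos (sub_pos.2 hx) (sub_pos.2 hy)]

/-- the oscillating distance correction
`g = 1 + b_r + b_b − 1{τ−1 > (τ−2)^{b_r} + (τ−2)^{b_b}}` lies in
`[2·log(2/(τ−1))/|log(τ−2)|, 2)`. -/
theorem distance_fluctuation_bounds
    (τ : ℝ) (hτ1 : 2 < τ) (hτ2 : τ < 3)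
    (br bb : ℝ) (hbr0 : 0 ≤ br) (hbr1 : br < 1) (hbb0 : 0 ≤ bb) (hbb1 : bb < 1) :
    2 * Real.log (2 / (τ - 1)) / |Real.log (τ - 2)| ≤
        1 + br + bb - (if (τ - 2) ^ br + (τ - 2) ^ bb < τ - 1 then (1 : ℝ) else 0) ∧
      1 + br + bb - (if (τ - 2) ^ br + (τ - 2) ^ bb < τ - 1 then (1 : ℝ) else 0) < 2 := by
  have ha0 : 0 < τ - 2 := by linarith
  have ha1 : τ - 2 < 1 := by linarith
  have hτ : 0 < τ - 1 := by linarith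
  have hlog : Real.log (τ - 2) < 0 := Real.log_neg ha0 ha1
  rw [abs_of_neg hlog, div_le_iff₀ (neg_pos.2 hlog), Real.log_div two_ne_zero hτ.ne']
  split_ifs with h
  · refine ⟨?_, by linarith⟩
    have hle : 2 * (τ - 2) ^ ((br + bb) / 2) ≤ τ - 1 :=
      (two_mul_rpow_half_add_le ha0 br bb).trans h.le
    have hpow : 0 < (τ - 2) ^ ((br + bb) / 2) := Real.rpow_pos_of_pos ha0 _
    have := Real.log_le_log (by positivity) hle
    rw [Real.log_mul two_ne_zero hpow.ne', Real.log_rpow ha0] at this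
    linarith
  · have hsum : br + bb < 1 :=
      add_lt_one_of_one_add_le_rpow_add_rpow ha0 ha1 hbr0 hbr1 hbb0 hbb1 (by linarith)
    refine ⟨?_, by linarith⟩
    have hle : 2 ^ 2 * (τ - 2) ≤ (τ - 1) ^ 2 := by nlinarith [sq_nonneg (τ - 3)]
    have := Real.log_le_log (by positivity) hle
    rw [Real.log_mul (by norm_num) ha0.ne', Real.log_pow, Real.log_pow] at this
    push_cast at this
    nlinarith [mul_nonneg (add_nonneg hbr0 hbb0) (neg_pos.2 hlog).le]
end

section
/- Let τ be a real number with 2 < τ < 3. Let T_r, T_b be integers and b_r, b_b ∈ [0,1) be real numbers such that (T_b + b_b) - (T_r + b_r) > 1 and (τ-2)^{b_r} + (τ-2)^{b_b} ≠ τ-1. Let O = 1 if T_b - T_r is even and O = 0 otherwise; let O_< = 1 if T_b - T_r is even and (τ-2)^{b_r} + (τ-2)^{b_b} > τ-1, and O_< = 0 otherwise; let O_> = 1 if T_b - T_r is even and (τ-2)^{b_r} + (τ-2)^{b_b} < τ-1, and O_> = 0 otherwise. Then (τ-2)^{(T_b - T_r - 1 - O)/2} · ( (τ-2)^{b_b +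 O_<} + (τ-1 - (τ-2)^{b_r})·(τ-2)^{O_>} ) < τ - 1. -/
/-- the deterministic core of non-coexistence: the exponent of the losing
colour's cluster size, `√(Y_b/Y_r)·f_n(Y_r,Y_b)`, expressed through `T_r, T_b, b_r, b_b`,
is strictly less than `τ-1`. -/
theorem losing_colour_exponent_lt
    (τ : ℝ) (hτ1 : 2 < τ) (hτ2 : τ < 3)
    (Tr Tb : ℤ) (br bb : ℝ)
    (hbr0 : 0 ≤ br) (hbr1 : br < 1) (hbb0 : 0 ≤ bb) (hbb1 : bb < 1)
    (hgap : 1 < ((Tb : ℝ) + bb) - ((Tr : ℝ) + br))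
    (hne : (τ - 2) ^ br + (τ - 2) ^ bb ≠ τ - 1) :
    (τ - 2) ^ ((((Tb : ℝ) - (Tr : ℝ)) - 1 -
          (if Even (Tb - Tr) then (1 : ℝ) else 0)) / 2) *
        ((τ - 2) ^ (bb +
            (if Even (Tb - Tr) ∧ τ - 1 < (τ - 2) ^ br + (τ - 2) ^ bb then (1 : ℝ) else 0)) +
          (τ - 1 - (τ - 2) ^ br) *
            (τ - 2) ^
              (if Even (Tb - Tr) ∧ (τ - 2) ^ br + (τ - 2) ^ bb < τ - 1 then (1 : ℝ) else 0))
      < τ - 1 := by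
  have ha0 : 0 < τ - 2 := by linarith
  have ha1 : τ - 2 < 1 := by linarith
  have hx0 : τ - 2 < (τ - 2) ^ br := by
    simpa using Real.rpow_lt_rpow_of_exponent_gt ha0 ha1 hbr1
  have hx1 : (τ - 2) ^ br ≤ 1 := Real.rpow_le_one ha0.le ha1.le hbr0
  have hy0 : τ - 2 < (τ - 2) ^ bb := by
    simpa using Real.rpow_lt_rpow_of_exponent_gt ha0 ha1 hbb1
  have hy1 : (τ - 2) ^ bb ≤ 1 := Real.rpow_le_one ha0.le ha1.le hbb0
  have hxy : Tb - Tr = 1 → (τ - 2) ^ bb < (τ - 2) ^ br := by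
    intro h
    have h' : (Tb : ℝ) - Tr = 1 := by exact_mod_cast h
    exact Real.rpow_lt_rpow_of_exponent_gt ha0 ha1 (by linarith)
  have hD : 0 < Tb - Tr := by
    have : (0 : ℝ) < ((Tb - Tr : ℤ) : ℝ) := by push_cast; linarith
    exact_mod_cast this
  have hcast : (Tb : ℝ) - Tr = ((Tb - Tr : ℤ) : ℝ) := by push_cast; rfl
  rw [hcast, Real.rpow_add ha0]
  generalize Tb - Tr = D at hxy hD ⊢
  generalize (τ - 2) ^ br = x at *
  generalize (τ - 2) ^ bb = y at *
  by_cases hE : Even D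
  · have hD2 : 2 ≤ D := by
      obtain ⟨k, rfl⟩ := hE
      omega
    have hD2' : (2 : ℝ) ≤ D := by exact_mod_cast hD2
    have hp : (τ - 2) ^ (((D : ℝ) - 1 - 1) / 2) ≤ 1 :=
      Real.rpow_le_one ha0.le ha1.le (by linarith)
    rcases lt_or_gt_of_ne hne with h | h
    · simp only [hE, h, not_lt_of_gt h, and_false, and_true, if_true, if_false, Real.rpow_zero,
        Real.rpow_one]
      refine (mul_le_of_le_one_left (by nlinarith) hp).trans_lt ?_
      nlinarith
    · simp only [hE, h, not_lt_of_gt h, and_false, and_true, if_true, if_false, Real.rpow_zero,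
        Real.rpow_one]
      refine (mul_le_of_le_one_left (by nlinarith) hp).trans_lt ?_
      nlinarith
  · simp only [hE, false_and, if_false, Real.rpow_zero, mul_one, sub_zero]
    by_cases h1 : D = 1
    · have := hxy h1
      simp only [h1, Int.cast_one, sub_self, zero_div, Real.rpow_zero]
      linarith
    · have hD3 : 3 ≤ D := by
        rw [Int.not_even_iff_odd] at hE
        obtain ⟨k, rfl⟩ := hE
        omega
      have hD3' : (3 : ℝ) ≤ D := by exact_mod_cast hD3
      have hp : (τ - 2) ^ (((D : ℝ) - 1) / 2) ≤ τ - 2 := by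
        simpa using Real.rpow_le_rpow_of_exponent_ge ha0 ha1.le
          (show (1 : ℝ) ≤ ((D : ℝ) - 1) / 2 by linarith)
      refine (mul_le_mul_of_nonneg_right hp (by linarith)).trans_lt ?_
      nlinarith
end
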